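/- Let Σ₀ be a closed strictly convex smooth initial hypersurface enclosing a shrinking obstacle Φ, and let {Σ_t}_{0≤t<T} be the solution of the penalized problem (∗_δ). Then the Gauss curvature of Σ_t satisfies inf_{𝕊^n×[0,T)} K ≥ c_T > 0, where one may take c_T = min_{𝕊^n×[0,T]}(−∂_tφ)^{1/α}; in particular c_T depends only on α, T, Φ and is independent of δ. -/

import Mathlib

/-!
STATEMENT 7: Let `Σ₀` be a closed strictly convex smooth initial hypersurface enclosing a
shrinking obstacle `Φ`, and let `{Σ_t}_{0≤t<T}` be the solution of the penalized problem
`(∗_δ)`.  Then the Gauss curvature of `Σ_t` satisfies `inf_{𝕊ⁿ×[0,T)} K ≥ c_T > 0`, where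
one may take `c_T = min_{𝕊ⁿ×[0,T]}(−∂_tφ)^{1/α}`; in particular `c_T` depends only on
`α, T, Φ` and is independent of `δ`.
-/

open scoped BigOperators RealInnerProductSpace
noncomputable section

abbrev ES (n : ℕ) := EuclideanSpace ℝ (Fin (n + 1))

/-- The unit sphere `𝕊^n ⊂ ℝ^{n+1}`. -/
def Sph (n : ℕ) : Set (ES n) := Metric.sphere 0 1

/-- Second derivative of `f` at `z` in the directions `v, w`. -/
def hbil {F : Type*} [NormedAddCommGroup F] [NormedSpace ℝ F] (f : F → ℝ) (z v w : F) : ℝ :=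
  fderiv ℝ (fun x => fderiv ℝ f x w) z v

/-- For the 1-homogeneous extension `U` of the support function of a convex body and a unit
vector `z`, `suppHessDet n U z = det(D²U(z) + z⊗z)` equals
`det(∇̄_i∇̄_j u + u ḡ_{ij})/det(ḡ_{ij})`, the product of the principal radii of curvature;
the Gauss curvature at the point with outer normal `z` is its inverse,
`K = det ḡ/det(∇̄²u + uḡ) = (suppHessDet n U z)⁻¹`. -/
def suppHessDet (n : ℕ) (U : ES n → ℝ) (z : ES n) : ℝ :=
  (Matrix.of fun i j : Fin (n + 1) =>
      hbil U z (EuclideanSpace.single i 1) (EuclideanSpace.single j 1) +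
        ⟪z, EuclideanSpace.single i 1⟫ * ⟪z, EuclideanSpace.single j 1⟫).det

/-- `u₀` is the (1-homogeneously extended) support function of a closed strictly convex
smooth hypersurface. -/
def IsSupportOfSmoothBody (n : ℕ) (u₀ : ES n → ℝ) : Prop :=
  (∀ c : ℝ, 0 < c → ∀ x, u₀ (c • x) = c * u₀ x) ∧
    ContDiffOn ℝ (⊤ : ℕ∞) u₀ {(0 : ES n)}ᶜ ∧
    ∀ z ∈ Sph n, ∀ v : ES n, ⟪v, z⟫ = 0 → v ≠ 0 → 0 < hbil u₀ z v v

/-- A shrinking obstacle `Φ_t = ∂Ω(t)`: a decreasing family of strictly convex bodies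
(whose limit contains the origin as interior point), with support functions
`φ ∈ C^{3,1}(𝕊ⁿ×[0,∞))` (extended 1-homogeneously), `∂_tφ < 0`, `−∂_tφ` non-increasing,
and principal curvatures `μ_i` positive, non-decreasing in `t` and bounded. -/
structure ShrinkingObstacle (n : ℕ) : Type where
  φ : ES n → ℝ → ℝ
  homog : ∀ t : ℝ, 0 ≤ t → ∀ c : ℝ, 0 < c → ∀ x, φ (c • x) t = c * φ x t
  smooth : ContDiffOn ℝ 3 (fun p : ES n × ℝ => φ p.1 p.2) ({(0 : ES n)}ᶜ ×ˢ Set.Ici 0)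
  φt : ES n → ℝ → ℝ
  hφt : ∀ z ∈ Sph n, ∀ t : ℝ, 0 ≤ t → HasDerivAt (φ z) (φt z t) t
  φt_neg : ∀ z ∈ Sph n, ∀ t : ℝ, 0 ≤ t → φt z t < 0
  speed_nonincreasing : ∀ z ∈ Sph n, ∀ s t : ℝ, 0 ≤ s → s ≤ t → φt z s ≤ φt z t
  μ : Fin n → ES n → ℝ → ℝ
  μ_pos : ∀ i, ∀ z ∈ Sph n, ∀ t : ℝ, 0 ≤ t → 0 < μ i z t
  μ_eigen : ∀ z ∈ Sph n, ∀ t : ℝ, 0 ≤ t → ∃ e : Fin n → ES n, Orthonormal ℝ e ∧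
    (∀ i, ⟪e i, z⟫ = 0) ∧
    ∀ i (v : ES n), hbil (fun x => φ x t) z (e i) v = (μ i z t)⁻¹ * ⟪e i, v⟫
  μ_mono : ∀ i, ∀ z ∈ Sph n, ∀ s t : ℝ, 0 ≤ s → s ≤ t → μ i z s ≤ μ i z t
  μ_bdd : ∃ M : ℝ, ∀ i, ∀ z ∈ Sph n, ∀ t : ℝ, 0 ≤ t → μ i z t ≤ M
  interior_point : ∃ ρ : ℝ, 0 < ρ ∧ ∀ z ∈ Sph n, ∀ t : ℝ, 0 ≤ t → ρ ≤ φ z t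

/-- The penalty function `β_δ(x) = C₀β(x/δ)`: smooth, non-decreasing, concave, vanishing on
`[δ,∞)`, affine on `(−∞,0)`, with `β_δ(0) = −C₀`. -/
structure Penalty (δ C₀ : ℝ) : Type where
  β : ℝ → ℝ
  smooth : ContDiff ℝ (⊤ : ℕ∞) β
  mono : Monotone β
  concave : ConcaveOn ℝ Set.univ β
  zero_of_ge : ∀ x : ℝ, δ ≤ x → β x = 0
  affine_on_neg : ∀ x : ℝ, x < 0 → deriv (deriv β) x = 0
  at_zero : β 0 = -C₀

/-- `C₀ = ‖K_Φ‖_{L^∞(𝕊ⁿ×[0,∞))}^α`, where `K_Φ = μ₁⋯μ_n` is the Gauss curvature of the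
obstacle. -/
def PenaltyConst (n : ℕ) (α : ℝ) (Φ : ShrinkingObstacle n) (C₀ : ℝ) : Prop :=
  C₀ = sSup {y : ℝ | ∃ z ∈ Sph n, ∃ t : ℝ, 0 ≤ t ∧ y = (∏ i, Φ.μ i z t) ^ α}

/-- A smooth solution of the penalized problem `(∗_δ)` on `[0,T)`:
`−∂_t u = K^α + β_δ(u − φ)`, where `u(·,t)` is the (1-homogeneously extended) support
function of a closed strictly convex smooth hypersurface `Σ_t` and
`K = (suppHessDet)⁻¹` is its Gauss curvature. -/
structure IsPenalizedSol (n : ℕ) (α T δ C₀ : ℝ) (Φ : ShrinkingObstacle n)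
    (P : Penalty δ C₀) (u : ES n → ℝ → ℝ) : Prop where
  homog : ∀ t ∈ Set.Ico (0 : ℝ) T, ∀ c : ℝ, 0 < c → ∀ x, u (c • x) t = c * u x t
  smooth : ContDiffOn ℝ (⊤ : ℕ∞) (fun p : ES n × ℝ => u p.1 p.2) ({(0 : ES n)}ᶜ ×ˢ Set.Ico 0 T)
  strict_convex : ∀ t ∈ Set.Ico (0 : ℝ) T, ∀ z ∈ Sph n, ∀ v : ES n,
    ⟪v, z⟫ = 0 → v ≠ 0 → 0 < hbil (fun x => u x t) z v v
  eqn : ∀ z ∈ Sph n, ∀ t ∈ Set.Ioo (0 : ℝ) T,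
    HasDerivAt (u z)
      (-((suppHessDet n (fun x => u x t) z) ^ (-α)) - P.β (u z t - Φ.φ z t)) t

/-- The initial hypersurface (with support function `u₀`) strictly encloses the obstacle,
together with the standing normalization `−∂_tφ(·,0) < min_{𝕊ⁿ} K₀^α` and
`−∂_tφ(·,0) < min_{𝕊ⁿ} K_{Φ₀}^α`. -/
def Encloses (n : ℕ) (α : ℝ) (u₀ : ES n → ℝ) (Φ : ShrinkingObstacle n) : Prop :=
  (∀ z ∈ Sph n, Φ.φ z 0 < u₀ z) ∧
    (∀ z ∈ Sph n, ∀ z' ∈ Sph n, -Φ.φt z 0 < ((suppHessDet n u₀ z')⁻¹) ^ α) ∧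
    (∀ z ∈ Sph n, ∀ z' ∈ Sph n, -Φ.φt z 0 < (∏ i, Φ.μ i z' 0) ^ α)

open Set Filter Topology Matrix

lemma Matrix.PosSemidef.one_le_det_one_add {m : Type*} [Fintype m] [DecidableEq m]
    {D : Matrix m m ℝ} (hD : D.PosSemidef) : 1 ≤ (1 + D).det := by
  have hH : (1 + D).IsHermitian := isHermitian_one.add hD.1
  rw [hH.det_eq_prod_eigenvalues]
  refine Finset.one_le_prod fun i _ => ?_
  set v := hH.eigenvectorBasis i with hv
  have h1 : ⟪v, v⟫ = 1 := by
    rw [real_inner_self_eq_norm_sq, hv, hH.eigenvectorBasis.orthonormal.1 i, one_pow]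
  have h2 := hH.eigenvalues_eq i
  have h3 := hD.re_dotProduct_nonneg (v.ofLp)
  simp only [RCLike.re_to_real, star_trivial, Matrix.add_mulVec, Matrix.one_mulVec,
    dotProduct_add] at h2 h3
  have h4 : v.ofLp ⬝ᵥ v.ofLp = 1 := by
    rw [← h1, PiLp.inner_apply]; simp [dotProduct, pow_two]
  simp only [← hv, h4] at h2
  simp only [RCLike.ofReal_real_eq_id, id]
  linarith

lemma Matrix.PosDef.det_le_det_add {m : Type*} [Fintype m] [DecidableEq m]
    {B C : Matrix m m ℝ} (hB : B.PosDef) (hC : C.PosSemidef) : B.det ≤ (B + C).det := by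
  obtain ⟨S, hS⟩ : ∃ S : Matrix m m ℝ, B = Sᴴ * S := by
    open scoped MatrixOrder in
    exact CStarAlgebra.nonneg_iff_eq_star_mul_self.1 hB.posSemidef.nonneg
  have hdet : B.det = Sᴴ.det * S.det := by rw [hS, det_mul]
  have hu : IsUnit S.det := by
    refine isUnit_iff_ne_zero.2 fun h => hB.det_pos.ne' ?_
    rw [hdet, h, mul_zero]
  have hu' : IsUnit Sᴴ.det := by
    refine isUnit_iff_ne_zero.2 fun h => hB.det_pos.ne' ?_
    rw [hdet, h, zero_mul]
  have hfac : B + C = Sᴴ * (1 + S⁻¹ᴴ * C * S⁻¹) * S := by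
    rw [Matrix.mul_add, Matrix.add_mul, Matrix.mul_one, ← hS, conjTranspose_nonsing_inv]
    simp only [← Matrix.mul_assoc]
    rw [mul_nonsing_inv _ hu', Matrix.one_mul, Matrix.mul_assoc, nonsing_inv_mul _ hu,
      Matrix.mul_one]
  have h1 := (hC.conjTranspose_mul_mul_same S⁻¹).one_le_det_one_add
  rw [hfac, det_mul, det_mul, mul_right_comm, ← hdet]
  exact le_mul_of_one_le_right hB.det_pos.le h1

/-- The second-order necessary condition at an interior minimum of a function of one variable. -/
lemma IsLocalMin.deriv_deriv_nonneg {f : ℝ → ℝ} {x : ℝ} (h : IsLocalMin f x)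
    (hc : ContinuousAt f x) : 0 ≤ deriv (deriv f) x := by
  by_contra! hlt
  have hmin : IsLocalMin (-f) x := by
    refine isLocalMin_of_deriv_deriv_pos ?_ ?_ hc.neg
    · have : deriv (-f) = -deriv f := by ext y; exact deriv.neg
      rw [this, deriv.neg]; linarith
    · rw [deriv.neg, h.deriv_eq_zero, neg_zero]
  have hconst : f =ᶠ[𝓝 x] fun _ => f x := by
    filter_upwards [h, hmin] with y h1 h2
    simp only [Pi.neg_apply] at h2
    linarith
  have := hconst.deriv.deriv_eq
  simp at this
  linarith

section SecondDerivative

variable {F : Type*} [NormedAddCommGroup F] [NormedSpace ℝ F] {f g : F → ℝ} {z : F}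

lemma differentiableAt_fderiv (hf : ContDiffAt ℝ 2 f z) : DifferentiableAt ℝ (fderiv ℝ f) z :=
  (hf.fderiv_right (m := 1) (by norm_num)).differentiableAt (by norm_num)

lemma hbil_eq (hf : ContDiffAt ℝ 2 f z) (v w : F) :
    hbil f z v w = fderiv ℝ (fderiv ℝ f) z v w := by
  rw [hbil, fderiv_clm_apply (differentiableAt_fderiv hf) (differentiableAt_const w)]
  simp

lemma hbil_comm (hf : ContDiffAt ℝ 2 f z) (v w : F) : hbil f z v w = hbil f z w v := by
  rw [hbil_eq hf, hbil_eq hf]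
  exact (hf.isSymmSndFDerivAt (by simp)).eq v w

lemma hbil_sub (hf : ContDiffAt ℝ 2 f z) (hg : ContDiffAt ℝ 2 g z) (v w : F) :
    hbil (fun x => f x - g x) z v w = hbil f z v w - hbil g z v w := by
  have hev : (fun x => fderiv ℝ (fun y => f y - g y) x w) =ᶠ[𝓝 z]
      fun x => fderiv ℝ f x w - fderiv ℝ g x w := by
    filter_upwards [hf.eventually (by simp), hg.eventually (by simp)] with x h1 h2
    rw [fderiv_fun_sub (h1.differentiableAt (by norm_num)) (h2.differentiableAt (by norm_num))]
    rfl
  have d : ∀ {k : F → ℝ}, ContDiffAt ℝ 2 k z → DifferentiableAt ℝ (fun x => fderiv ℝ k x w) z :=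
    fun h => (differentiableAt_fderiv h).clm_apply (differentiableAt_const w)
  rw [hbil, hev.fderiv_eq, fderiv_fun_sub (d hf) (d hg)]
  rfl

lemma Filter.EventuallyEq.hbil_eq (h : f =ᶠ[𝓝 z] g) (v w : F) : hbil f z v w = hbil g z v w := by
  have : (fun x => fderiv ℝ f x w) =ᶠ[𝓝 z] fun x => fderiv ℝ g x w :=
    (h.fderiv (𝕜 := ℝ)).mono fun x hx => congrArg (· w) hx
  rw [hbil, hbil, this.fderiv_eq]

lemma hbil_nonneg_of_isLocalMin_line (hf : ContDiffAt ℝ 2 f z) (v : F)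
    (h : IsLocalMin (fun s : ℝ => f (z + s • v)) 0) : 0 ≤ hbil f z v v := by
  have hl : ∀ s : ℝ, HasDerivAt (fun s : ℝ => z + s • v) v s := fun s => by
    simpa using ((hasDerivAt_id s).smul_const v).const_add z
  have hl0 : Tendsto (fun s : ℝ => z + s • v) (𝓝 0) (𝓝 z) := by
    simpa [ContinuousAt] using (hl 0).continuousAt
  have h1 : deriv (fun s : ℝ => f (z + s • v)) =ᶠ[𝓝 0] fun s => fderiv ℝ f (z + s • v) v := by
    filter_upwards [hl0.eventually (hf.eventually (by simp))] with s hs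
    exact ((hs.differentiableAt (by norm_num)).hasFDerivAt.comp_hasDerivAt s (hl s)).deriv
  have h2 : HasDerivAt (fun s : ℝ => fderiv ℝ f (z + s • v) v) (hbil f z v v) 0 := by
    have hd : DifferentiableAt ℝ (fun x => fderiv ℝ f x v) (z + (0 : ℝ) • v) := by
      simpa using (differentiableAt_fderiv hf).clm_apply (differentiableAt_const v)
    have := hd.hasFDerivAt.comp_hasDerivAt (0 : ℝ) (hl 0)
    simpa [hbil, Function.comp_def] using this
  have h3 := h.deriv_deriv_nonneg
    (ContinuousAt.comp (g := f) (by simpa using hf.continuousAt) (hl 0).continuousAt)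
  rwa [h1.deriv_eq, h2.deriv] at h3

lemma hbil_self_left_of_homog (hf : ContDiffAt ℝ 2 f z)
    (hh : ∀ c : ℝ, 0 < c → ∀ x, f (c • x) = c * f x) (w : F) : hbil f z z w = 0 := by
  have hconst : ∀ᶠ c : ℝ in 𝓝 1, fderiv ℝ f (c • z) w = fderiv ℝ f z w := by
    filter_upwards [lt_mem_nhds zero_lt_one] with c hc
    have h1 : fderiv ℝ (fun x => f (c • x)) z = c • fderiv ℝ f (c • z) := fderiv_comp_smul c
    have h2 : (fun x => f (c • x)) = fun x => c * f x := funext (hh c hc)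
    rw [h2, fderiv_const_mul (hf.differentiableAt (by norm_num))] at h1
    exact (congrArg (· w) (smul_right_injective _ hc.ne' h1)).symm
  have hd : DifferentiableAt ℝ (fun x => fderiv ℝ f x w) ((1 : ℝ) • z) := by
    simpa using (differentiableAt_fderiv hf).clm_apply (differentiableAt_const w)
  have h1 := hd.hasFDerivAt.comp_hasDerivAt (1 : ℝ) ((hasDerivAt_id (1 : ℝ)).smul_const z)
  have h2 : HasDerivAt (fun c : ℝ => fderiv ℝ f (c • z) w) 0 1 :=
    (hasDerivAt_const _ _).congr_of_eventuallyEq hconst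
  have := h1.unique h2
  simpa [hbil] using this

end SecondDerivative

section SupportFunction

variable {n : ℕ} {U V : ES n → ℝ} {z : ES n}

/-- The matrix `D²U(z) + z ⊗ z` whose determinant is `suppHessDet n U z`. -/
def suppHessMat (n : ℕ) (U : ES n → ℝ) (z : ES n) : Matrix (Fin (n + 1)) (Fin (n + 1)) ℝ :=
  Matrix.of fun i j =>
    hbil U z (EuclideanSpace.single i 1) (EuclideanSpace.single j 1) +
      ⟪z, EuclideanSpace.single i 1⟫ * ⟪z, EuclideanSpace.single j 1⟫

lemma suppHessMat_isHermitian (hU : ContDiffAt ℝ 2 U z) : (suppHessMat n U z).IsHermitian := by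
  ext i j
  simp only [suppHessMat, conjTranspose_apply, of_apply, star_trivial]
  rw [hbil_comm hU, mul_comm]

lemma dotProduct_suppHessMat_mulVec (hU : ContDiffAt ℝ 2 U z) (x : ES n) :
    x.ofLp ⬝ᵥ suppHessMat n U z *ᵥ x.ofLp = hbil U z x x + ⟪z, x⟫ ^ 2 := by
  have hx : x = ∑ i, x i • EuclideanSpace.single i (1 : ℝ) := by
    ext j
    simp [Finset.sum_apply, Pi.single_apply]
  have h1 : hbil U z x x = ∑ i, ∑ j, x i * x j *
      hbil U z (EuclideanSpace.single i 1) (EuclideanSpace.single j 1) := by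
    simp only [hbil_eq hU]
    conv_lhs => rw [hx]
    simp only [map_sum, map_smul, _root_.sum_apply, _root_.smul_apply,
      smul_eq_mul, Finset.mul_sum]
    rw [Finset.sum_comm]
    exact Finset.sum_congr rfl fun i _ => Finset.sum_congr rfl fun j _ => by ring
  have h2 : ⟪z, x⟫ = ∑ i, x i * ⟪z, EuclideanSpace.single i (1 : ℝ)⟫ := by
    conv_lhs => rw [hx]
    simp [inner_sum, inner_smul_right]
  rw [h1, h2, pow_two, Finset.sum_mul_sum, ← Finset.sum_add_distrib]
  simp only [dotProduct, mulVec, suppHessMat, of_apply, Finset.mul_sum, ← Finset.sum_add_distrib]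
  exact Finset.sum_congr rfl fun i _ => Finset.sum_congr rfl fun j _ => by ring

lemma hbil_tangential (hU : ContDiffAt ℝ 2 U z)
    (hh : ∀ c : ℝ, 0 < c → ∀ x, U (c • x) = c * U x) (a : ℝ) (w : ES n) :
    hbil U z (a • z + w) (a • z + w) = hbil U z w w := by
  have h1 : ∀ w, fderiv ℝ (fderiv ℝ U) z z w = 0 := fun w => by
    rw [← hbil_eq hU, hbil_self_left_of_homog hU hh]
  have h2 : ∀ w, fderiv ℝ (fderiv ℝ U) z w z = 0 := fun w => by
    rw [← hbil_eq hU, hbil_comm hU, hbil_self_left_of_homog hU hh]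
  simp [hbil_eq hU, h1, h2]

lemma exists_tangential_decomp (hz : z ∈ Sph n) (x : ES n) :
    ∃ (a : ℝ) (w : ES n), x = a • z + w ∧ ⟪w, z⟫ = 0 ∧ ⟪z, x⟫ = a := by
  have hzz : ⟪z, z⟫ = 1 := by
    rw [real_inner_self_eq_norm_sq, mem_sphere_zero_iff_norm.1 hz, one_pow]
  refine ⟨⟪z, x⟫, x - ⟪z, x⟫ • z, by simp, ?_, rfl⟩
  rw [inner_sub_left, inner_smul_left, hzz, real_inner_comm]
  simp

lemma suppHessMat_posDef (hz : z ∈ Sph n) (hU : ContDiffAt ℝ 2 U z)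
    (hh : ∀ c : ℝ, 0 < c → ∀ x, U (c • x) = c * U x)
    (hpos : ∀ v : ES n, ⟪v, z⟫ = 0 → v ≠ 0 → 0 < hbil U z v v) :
    (suppHessMat n U z).PosDef := by
  refine .of_dotProduct_mulVec_pos (suppHessMat_isHermitian hU) fun y hy => ?_
  obtain ⟨a, w, hx, hw, ha⟩ := exists_tangential_decomp hz (WithLp.toLp 2 y)
  have h := dotProduct_suppHessMat_mulVec hU (WithLp.toLp 2 y)
  rw [ha, hx, hbil_tangential hU hh, ← hx] at h
  rw [star_trivial]
  refine h.symm ▸ ?_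
  rcases eq_or_ne w 0 with rfl | hw0
  · have ha0 : a ≠ 0 := by
      rintro rfl
      exact hy (by simpa using hx)
    have : hbil U z 0 0 = 0 := by simp [hbil_eq hU]
    rw [this, zero_add]
    positivity
  · exact add_pos_of_pos_of_nonneg (hpos w hw hw0) (sq_nonneg a)

lemma suppHessDet_pos (hz : z ∈ Sph n) (hU : ContDiffAt ℝ 2 U z)
    (hh : ∀ c : ℝ, 0 < c → ∀ x, U (c • x) = c * U x)
    (hpos : ∀ v : ES n, ⟪v, z⟫ = 0 → v ≠ 0 → 0 < hbil U z v v) :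
    0 < suppHessDet n U z :=
  (suppHessMat_posDef hz hU hh hpos).det_pos

lemma suppHessDet_mono (hz : z ∈ Sph n) (hU : ContDiffAt ℝ 2 U z) (hV : ContDiffAt ℝ 2 V z)
    (hhU : ∀ c : ℝ, 0 < c → ∀ x, U (c • x) = c * U x)
    (hhV : ∀ c : ℝ, 0 < c → ∀ x, V (c • x) = c * V x)
    (hpos : ∀ v : ES n, ⟪v, z⟫ = 0 → v ≠ 0 → 0 < hbil U z v v)
    (hle : ∀ v : ES n, ⟪v, z⟫ = 0 → hbil U z v v ≤ hbil V z v v) :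
    suppHessDet n U z ≤ suppHessDet n V z := by
  have hC : (suppHessMat n V z - suppHessMat n U z).PosSemidef := by
    refine .of_dotProduct_mulVec_nonneg
      ((suppHessMat_isHermitian hV).sub (suppHessMat_isHermitian hU)) fun y => ?_
    obtain ⟨a, w, hx, hw, ha⟩ := exists_tangential_decomp hz (WithLp.toLp 2 y)
    have h1 := dotProduct_suppHessMat_mulVec hU (WithLp.toLp 2 y)
    have h2 := dotProduct_suppHessMat_mulVec hV (WithLp.toLp 2 y)
    rw [ha, hx, hbil_tangential hU hhU, ← hx] at h1
    rw [ha, hx, hbil_tangential hV hhV, ← hx] at h2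
    have h3 := hle w hw
    rw [star_trivial, sub_mulVec, dotProduct_sub]
    linarith
  have := (suppHessMat_posDef hz hU hhU hpos).det_le_det_add hC
  rwa [add_sub_cancel] at this

/-- If `U - V` restricted to the sphere attains a nonnegative minimum at `z`, then so does it along
tangent lines, by homogeneity. -/
lemma hbil_le_of_min_sub (hz : z ∈ Sph n) (hU : ContDiffAt ℝ 2 U z) (hV : ContDiffAt ℝ 2 V z)
    (hhU : ∀ c : ℝ, 0 < c → ∀ x, U (c • x) = c * U x)
    (hhV : ∀ c : ℝ, 0 < c → ∀ x, V (c • x) = c * V x)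
    (hnn : 0 ≤ V z - U z) (hmin : ∀ y ∈ Sph n, V z - U z ≤ V y - U y)
    {v : ES n} (hv : ⟪v, z⟫ = 0) : hbil U z v v ≤ hbil V z v v := by
  have h := hbil_nonneg_of_isLocalMin_line (hV.sub hU) v ?_
  · rw [hbil_sub hV hU] at h
    linarith
  refine Eventually.of_forall fun s => ?_
  have hz1 : ‖z‖ = 1 := mem_sphere_zero_iff_norm.1 hz
  have hnorm : 1 ≤ ‖z + s • v‖ := by
    have h1 : ‖z + s • v‖ ^ 2 = 1 + ‖s • v‖ ^ 2 := by
      rw [norm_add_sq_real, hz1, inner_smul_right, real_inner_comm, hv]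
      ring
    nlinarith [sq_nonneg ‖s • v‖, norm_nonneg (z + s • v)]
  set r := ‖z + s • v‖ with hr
  have hr0 : 0 < r := by linarith
  have hy : r⁻¹ • (z + s • v) ∈ Sph n := by
    rw [Sph, mem_sphere_zero_iff_norm, norm_smul, ← hr, Real.norm_of_nonneg (by positivity),
      inv_mul_cancel₀ hr0.ne']
  have h1 := hmin _ hy
  rw [hhU _ (by positivity), hhV _ (by positivity), ← mul_sub, inv_mul_eq_div,
    le_div_iff₀ hr0] at h1
  simp only [zero_smul, add_zero]
  nlinarith

end SupportFunction

section TimeDependent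

variable {E : Type*} [NormedAddCommGroup E] [NormedSpace ℝ E]

lemma fderiv_slice_eq {f : E × ℝ → ℝ} {O : Set E} {I : Set ℝ} {x : E} {t : ℝ} (hO : IsOpen O)
    (hf : DifferentiableWithinAt ℝ f (O ×ˢ I) (x, t)) (hx : x ∈ O) (ht : t ∈ I) (w : E) :
    fderiv ℝ (fun y => f (y, t)) x w = fderivWithin ℝ f (O ×ˢ I) (x, t) (w, 0) := by
  have h1 : HasFDerivWithinAt (fun y : E => (y, t)) (ContinuousLinearMap.inl ℝ E ℝ) O x :=
    (hasFDerivAt_prodMk_left x t).hasFDerivWithinAt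
  have hm : MapsTo (fun y : E => (y, t)) O (O ×ˢ I) := fun y hy => ⟨hy, ht⟩
  have h2 := (hf.hasFDerivWithinAt.comp x h1 hm).hasFDerivAt (hO.mem_nhds hx)
  have h3 : fderiv ℝ (fun y => f (y, t)) x = _ := h2.fderiv
  rw [h3]
  simp

lemma ContDiffOn.fderiv_slice {f : E × ℝ → ℝ} {O : Set E} {I : Set ℝ} (hO : IsOpen O)
    (hI : UniqueDiffOn ℝ I) (hf : ContDiffOn ℝ (⊤ : ℕ∞) f (O ×ˢ I)) (w : E) :
    ContDiffOn ℝ (⊤ : ℕ∞) (fun p : E × ℝ => fderiv ℝ (fun y => f (y, p.2)) p.1 w) (O ×ˢ I) := by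
  have h1 : ContDiffOn ℝ (⊤ : ℕ∞) (fun p => fderivWithin ℝ f (O ×ˢ I) p (w, 0)) (O ×ˢ I) :=
    (hf.fderivWithin (hO.uniqueDiffOn.prod hI) (by simp)).clm_apply contDiffOn_const
  refine h1.congr fun p hp => ?_
  exact fderiv_slice_eq hO (hf.differentiableOn (by simp) p hp) hp.1 hp.2 w

lemma continuousOn_hbil_slice {u : E → ℝ → ℝ} {O : Set E} {I : Set ℝ} (hO : IsOpen O)
    (hI : UniqueDiffOn ℝ I)
    (hu : ContDiffOn ℝ (⊤ : ℕ∞) (fun p : E × ℝ => u p.1 p.2) (O ×ˢ I)) (v w : E) :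
    ContinuousOn (fun p : E × ℝ => hbil (fun x => u x p.2) p.1 v w) (O ×ˢ I) :=
  ((hu.fderiv_slice hO hI w).fderiv_slice hO hI v).continuousOn

lemma continuousOn_suppHessDet {n : ℕ} {u : ES n → ℝ → ℝ} {I : Set ℝ} (hI : UniqueDiffOn ℝ I)
    (hu : ContDiffOn ℝ (⊤ : ℕ∞) (fun p : ES n × ℝ => u p.1 p.2) ({(0 : ES n)}ᶜ ×ˢ I)) :
    ContinuousOn (fun p : ES n × ℝ => suppHessDet n (fun x => u x p.2) p.1)
      ({(0 : ES n)}ᶜ ×ˢ I) := by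
  unfold suppHessDet
  refine continuous_id.matrix_det.comp_continuousOn (continuousOn_pi.2 fun i => continuousOn_pi.2 fun j => ?_)
  refine (continuousOn_hbil_slice isOpen_compl_singleton hI hu _ _).add ?_
  fun_prop

/-- A continuous function on `K × [0, b]`, positive at time `0`, which is somewhere nonpositive has
a first time at which it is nonpositive. -/
lemma exists_first_nonpos {X : Type*} [TopologicalSpace X] [T2Space X] {K : Set X} (hK : IsCompact K)
    {b : ℝ} {f : X × ℝ → ℝ} (hf : ContinuousOn f (K ×ˢ Icc 0 b)) (h0 : ∀ x ∈ K, 0 < f (x, 0))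
    {p : X × ℝ} (hp : p ∈ K ×ˢ Icc 0 b) (hfp : f p ≤ 0) :
    ∃ x ∈ K, ∃ t ∈ Ioc 0 b, f (x, t) ≤ 0 ∧ ∀ y ∈ K, ∀ s ∈ Ico 0 t, 0 < f (y, s) := by
  have hc : IsCompact (K ×ˢ Icc 0 b) := hK.prod isCompact_Icc
  have hc' : IsCompact ((K ×ˢ Icc 0 b) ∩ f ⁻¹' Iic 0) :=
    hc.of_isClosed_subset (hf.preimage_isClosed_of_isClosed hc.isClosed isClosed_Iic)
      inter_subset_left
  obtain ⟨⟨x, t⟩, ⟨⟨hx, ht⟩, hft⟩, hmin⟩ :=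
    hc'.exists_isMinOn ⟨p, hp, hfp⟩ continuous_snd.continuousOn
  refine ⟨x, hx, t, ⟨lt_of_le_of_ne ht.1 ?_, ht.2⟩, hft, fun y hy s hs => ?_⟩
  · rintro rfl
    exact (h0 x hx).not_ge hft
  · by_contra! hle
    have := isMinOn_iff.1 hmin (y, s) ⟨⟨hy, hs.1, hs.2.le.trans ht.2⟩, hle⟩
    exact hs.2.not_ge this

end TimeDependent

section Penalized

variable {n : ℕ} {z : ES n}

lemma ne_zero_of_mem_Sph (hz : z ∈ Sph n) : z ∈ ({(0 : ES n)}ᶜ : Set (ES n)) := by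
  rintro rfl
  simp [Sph] at hz

lemma isCompact_Sph (n : ℕ) : IsCompact (Sph n) := isCompact_sphere 0 1

lemma Sph_nonempty (n : ℕ) : (Sph n).Nonempty :=
  ⟨EuclideanSpace.single 0 1, by simp [Sph]⟩

/-- If `f` decreases strictly faster than linearly with slope `c`, then so do its increments. -/
lemma add_mul_lt_of_deriv_lt {f f' : ℝ → ℝ} {a b c : ℝ} (hab : a < b)
    (hc : ContinuousOn f (Icc a b)) (hf : ∀ t ∈ Ioo a b, HasDerivAt f (f' t) t)
    (hlt : ∀ t ∈ Ioo a b, f' t < -c) : f b + c * (b - a) < f a := by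
  obtain ⟨t, ht, hs⟩ := exists_hasDerivAt_eq_slope f f' hab hc hf
  have h := hlt t ht
  rw [hs, div_lt_iff₀ (sub_pos.2 hab)] at h
  linarith

lemma add_mul_le_of_deriv_le {f f' : ℝ → ℝ} {a b c : ℝ} (hab : a < b)
    (hc : ContinuousOn f (Icc a b)) (hf : ∀ t ∈ Ioo a b, HasDerivAt f (f' t) t)
    (hle : ∀ t ∈ Ioo a b, f' t ≤ -c) : f b + c * (b - a) ≤ f a := by
  obtain ⟨t, ht, hs⟩ := exists_hasDerivAt_eq_slope f f' hab hc hf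
  have h := hle t ht
  rw [hs, div_le_iff₀ (sub_pos.2 hab)] at h
  linarith

lemma deriv_nonpos_of_le_left {f : ℝ → ℝ} {f' a b : ℝ} (hab : a < b) (hf : HasDerivAt f f' b)
    (hle : ∀ s ∈ Ico a b, f b ≤ f s) : f' ≤ 0 := by
  have h := (hasDerivAt_iff_tendsto_slope_left_right.1 hf).1
  refine le_of_tendsto h ?_
  filter_upwards [Ioo_mem_nhdsLT hab] with s hs
  rw [slope_def_field]
  exact div_nonpos_of_nonneg_of_nonpos (sub_nonneg.2 (hle s ⟨hs.1.le, hs.2⟩)) (by linarith [hs.2])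

lemma deriv_le_of_increment_le {f : ℝ → ℝ} {f' t c h₀ : ℝ} (hh₀ : 0 < h₀) (hf : HasDerivAt f f' t)
    (hle : ∀ h ∈ Ioo 0 h₀, f (t + h) + c * h ≤ f t) : f' ≤ -c := by
  have h := (hasDerivAt_iff_tendsto_slope_left_right.1 hf).2
  refine le_of_tendsto h ?_
  filter_upwards [Ioo_mem_nhdsGT (show t < t + h₀ by linarith)] with s hs
  have := hle (s - t) ⟨by linarith [hs.1], by linarith [hs.2]⟩
  rw [add_sub_cancel] at this
  rw [slope_def_field, div_le_iff₀ (by linarith [hs.1])]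
  linarith

lemma Penalty.nonpos {δ C₀ : ℝ} (P : Penalty δ C₀) (x : ℝ) : P.β x ≤ 0 := by
  rw [← P.zero_of_ge _ (le_max_right x δ)]
  exact P.mono (le_max_left x δ)

lemma ShrinkingObstacle.continuousOn (Φ : ShrinkingObstacle n) :
    ContinuousOn (fun p : ES n × ℝ => Φ.φ p.1 p.2) (Sph n ×ˢ Ici 0) :=
  Φ.smooth.continuousOn.mono (prod_mono_left fun _ h => ne_zero_of_mem_Sph h)

/-- The speed of the obstacle is bounded below by a positive constant on bounded time intervals. -/
lemma ShrinkingObstacle.exists_speed_lower_bound (Φ : ShrinkingObstacle n) {T : ℝ} (hT : 0 < T) :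
    ∃ m, 0 < m ∧ ∀ z ∈ Sph n, ∀ t ∈ Icc 0 T, m ≤ -Φ.φt z t := by
  set S : Set (ES n × ℝ) := {(0 : ES n)}ᶜ ×ˢ Ici 0 with hS
  set f : ES n × ℝ → ℝ := fun p => Φ.φ p.1 p.2 with hf
  have heq : ∀ z ∈ Sph n, Φ.φt z T = fderivWithin ℝ f S (z, T) (0, 1) := fun z hz => by
    have hmem : (z, T) ∈ S := ⟨ne_zero_of_mem_Sph hz, hT.le⟩
    have hd : HasFDerivWithinAt f (fderivWithin ℝ f S (z, T)) S (z, T) :=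
      (Φ.smooth.differentiableOn (by norm_num) _ hmem).hasFDerivWithinAt
    have hl : HasDerivWithinAt (fun s : ℝ => (z, s)) ((0 : ES n), (1 : ℝ)) (Ici 0) T :=
      ((hasDerivAt_const T z).prodMk (hasDerivAt_id T)).hasDerivWithinAt
    have hm : MapsTo (fun s : ℝ => (z, s)) (Ici 0) S := fun s hs => ⟨ne_zero_of_mem_Sph hz, hs⟩
    have := (hd.comp_hasDerivWithinAt T hl hm).hasDerivAt (Ici_mem_nhds hT)
    exact (Φ.hφt z hz T hT.le).unique this
  have hcont : ContinuousOn (fun z => -Φ.φt z T) (Sph n) := by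
    have h1 : ContinuousOn (fun p => fderivWithin ℝ f S p) S :=
      Φ.smooth.continuousOn_fderivWithin
        (isOpen_compl_singleton.uniqueDiffOn.prod (uniqueDiffOn_Ici 0)) (by norm_num)
    have hm : MapsTo (fun z : ES n => (z, T)) (Sph n) S := fun z hz =>
      ⟨ne_zero_of_mem_Sph hz, hT.le⟩
    have h2 := (h1.comp (by fun_prop) hm).clm_apply
      (continuousOn_const (c := ((0 : ES n), (1 : ℝ))))
    exact (h2.congr heq).neg
  obtain ⟨x, hx, hmin⟩ := (isCompact_Sph n).exists_isMinOn (Sph_nonempty n) hcont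
  refine ⟨-Φ.φt x T, neg_pos.2 (Φ.φt_neg x hx T hT.le), fun z hz t ht => ?_⟩
  have h1 : -Φ.φt x T ≤ -Φ.φt z T := isMinOn_iff.1 hmin z hz
  linarith [Φ.speed_nonincreasing z hz t T ht.1 ht.2]

lemma suppHessDet_congr_of_eqOn_Sph {U V : ES n → ℝ}
    (hU : ∀ c : ℝ, 0 < c → ∀ x, U (c • x) = c * U x)
    (hV : ∀ c : ℝ, 0 < c → ∀ x, V (c • x) = c * V x) (h : EqOn U V (Sph n)) (hz : z ∈ Sph n) :
    suppHessDet n U z = suppHessDet n V z := by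
  have hev : U =ᶠ[𝓝 z] V := by
    filter_upwards [isOpen_compl_singleton.mem_nhds (ne_zero_of_mem_Sph hz)] with x hx
    have hx0 : 0 < ‖x‖ := norm_pos_iff.2 hx
    have hy : ‖x‖⁻¹ • x ∈ Sph n := by
      rw [Sph, mem_sphere_zero_iff_norm, norm_smul, norm_inv, norm_norm, inv_mul_cancel₀ hx0.ne']
    have hxy : x = ‖x‖ • (‖x‖⁻¹ • x) := by rw [smul_inv_smul₀ hx0.ne']
    rw [hxy, hU _ hx0, hV _ hx0, h hy]
  simp only [suppHessDet, hev.hbil_eq]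

namespace IsPenalizedSol

variable {α T δ C₀ c : ℝ} {Φ : ShrinkingObstacle n} {P : Penalty δ C₀} {u : ES n → ℝ → ℝ}

lemma contDiffAt (hu : IsPenalizedSol n α T δ C₀ Φ P u) {t : ℝ} (ht : t ∈ Ico 0 T)
    (hz : z ∈ Sph n) : ContDiffAt ℝ 2 (fun x => u x t) z := by
  have hm : MapsTo (fun x : ES n => (x, t)) {(0 : ES n)}ᶜ ({(0 : ES n)}ᶜ ×ˢ Ico 0 T) :=
    fun x hx => ⟨hx, ht⟩
  have h : ContDiffOn ℝ (⊤ : ℕ∞) (fun x => u x t) {(0 : ES n)}ᶜ :=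
    hu.smooth.comp (contDiff_prodMk_left t).contDiffOn hm
  exact contDiffAt_infty.1
    (h.contDiffAt (isOpen_compl_singleton.mem_nhds (ne_zero_of_mem_Sph hz))) 2

lemma suppHessDet_pos (hu : IsPenalizedSol n α T δ C₀ Φ P u) {t : ℝ} (ht : t ∈ Ico 0 T)
    (hz : z ∈ Sph n) : 0 < suppHessDet n (fun x => u x t) z :=
  _root_.suppHessDet_pos hz (hu.contDiffAt ht hz) (hu.homog t ht) (hu.strict_convex t ht z hz)

lemma continuousOn (hu : IsPenalizedSol n α T δ C₀ Φ P u) :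
    ContinuousOn (fun p : ES n × ℝ => u p.1 p.2) (Sph n ×ˢ Ico 0 T) :=
  hu.smooth.continuousOn.mono (prod_mono_left fun _ h => ne_zero_of_mem_Sph h)

lemma continuousOn_slice (hu : IsPenalizedSol n α T δ C₀ Φ P u) (hz : z ∈ Sph n) :
    ContinuousOn (u z) (Ico 0 T) :=
  hu.continuousOn.comp (f := fun t => (z, t)) (by fun_prop) fun _ ht => ⟨hz, ht⟩

lemma continuousOn_speed (hu : IsPenalizedSol n α T δ C₀ Φ P u) :
    ContinuousOn (fun p : ES n × ℝ => suppHessDet n (fun x => u x p.2) p.1 ^ (-α) +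
      P.β (u p.1 p.2 - Φ.φ p.1 p.2)) (Sph n ×ˢ Ico 0 T) := by
  have h1 := (continuousOn_suppHessDet (uniqueDiffOn_Ico 0 T) hu.smooth).mono
    (prod_mono_left fun _ h => ne_zero_of_mem_Sph h : Sph n ×ˢ Ico 0 T ⊆ _)
  refine (h1.rpow_const fun p hp => Or.inl (hu.suppHessDet_pos hp.2 hp.1).ne').add ?_
  exact P.smooth.continuous.comp_continuousOn
    (hu.continuousOn.sub (Φ.continuousOn.mono (prod_mono_right Ico_subset_Ici_self)))

/-- If the initial speed exceeds `c`, then `u` decreases at rate at least `c` for a short time. -/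
lemma exists_short_time_decrease (hu : IsPenalizedSol n α T δ C₀ Φ P u) (hT : 0 < T)
    (hinit : ∀ z ∈ Sph n, c < suppHessDet n (fun x => u x 0) z ^ (-α) + P.β (u z 0 - Φ.φ z 0)) :
    ∃ h₀, 0 < h₀ ∧ h₀ < T ∧ ∀ h ∈ Ioo 0 h₀, ∀ z ∈ Sph n, u z h + c * h < u z 0 := by
  obtain ⟨h₀, hh₀, hh₀T, hsp⟩ : ∃ h₀, 0 < h₀ ∧ h₀ < T ∧ ∀ z ∈ Sph n, ∀ t ∈ Ico 0 h₀,
      0 < suppHessDet n (fun x => u x t) z ^ (-α) + P.β (u z t - Φ.φ z t) - c := by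
    by_cases hex : ∃ p ∈ Sph n ×ˢ Icc 0 (T / 2),
        suppHessDet n (fun x => u x p.2) p.1 ^ (-α) + P.β (u p.1 p.2 - Φ.φ p.1 p.2) - c ≤ 0
    · obtain ⟨p, hp, hle⟩ := hex
      have hc := (hu.continuousOn_speed.mono
        (prod_mono_right (Icc_subset_Ico_right (half_lt_self hT)))).sub
          (continuousOn_const (c := c))
      obtain ⟨x, hx, t, ht, -, hlt⟩ := exists_first_nonpos (isCompact_Sph n) hc
        (fun z hz => sub_pos.2 (hinit z hz)) hp hle
      exact ⟨t, ht.1, by linarith [ht.2], hlt⟩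
    · push Not at hex
      exact ⟨T / 2, by linarith, by linarith, fun z hz t ht => hex (z, t) ⟨hz, ht.1, ht.2.le⟩⟩
  refine ⟨h₀, hh₀, hh₀T, fun h hh z hz => ?_⟩
  have := add_mul_lt_of_deriv_lt (c := c) hh.1
    ((hu.continuousOn_slice hz).mono (Icc_subset_Ico_right (hh.2.trans hh₀T)))
    (fun t ht => hu.eqn z hz t ⟨ht.1, (ht.2.trans hh.2).trans hh₀T⟩)
    (fun t ht => by linarith [hsp z hz t ⟨ht.1.le, ht.2.trans hh.2⟩])
  simpa using this

/-- Comparison of the flow with its time translate, at the first time the inequality fails. -/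
lemma translate_decrease (hu : IsPenalizedSol n α T δ C₀ Φ P u) (hα : 0 < α) (hc : 0 < c)
    (hφ : ∀ z ∈ Sph n, ∀ t ∈ Icc 0 T, c ≤ -Φ.φt z t) {h : ℝ} (hh : 0 < h)
    (hh0 : ∀ z ∈ Sph n, u z h + c * h < u z 0) (hz : z ∈ Sph n) {t : ℝ} (ht : 0 ≤ t)
    (hth : t + h < T) : u z (t + h) + c * h ≤ u z t := by
  refine le_of_forall_pos_lt_add fun η hη => ?_
  obtain ⟨ε, hε, hε1, hε2⟩ : ∃ ε, 0 < ε ∧ ε * t ≤ c * h ∧ ε * t ≤ η := by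
    have ht1 : 0 < t + 1 := by linarith
    refine ⟨min (c * h) η / (t + 1), by positivity, ?_, ?_⟩ <;>
      rw [div_mul_eq_mul_div, div_le_iff₀ ht1]
    · nlinarith [min_le_left (c * h) η, mul_pos hc hh]
    · nlinarith [min_le_right (c * h) η, mul_pos hc hh]
  set G : ES n × ℝ → ℝ := fun p => u p.1 p.2 - u p.1 (p.2 + h) - c * h + ε * p.2 with hG
  suffices hpos : 0 < G (z, t) by
    simp only [hG] at hpos
    linarith
  by_contra! hneg
  have hGc : ContinuousOn G (Sph n ×ˢ Icc 0 t) := by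
    have h1 : ContinuousOn (fun p : ES n × ℝ => u p.1 p.2) (Sph n ×ˢ Icc 0 t) :=
      hu.continuousOn.mono (prod_mono_right (Icc_subset_Ico_right (by linarith)))
    have h2 : ContinuousOn (fun p : ES n × ℝ => u p.1 (p.2 + h)) (Sph n ×ˢ Icc 0 t) :=
      hu.continuousOn.comp (f := fun p : ES n × ℝ => (p.1, p.2 + h)) (by fun_prop)
        fun p hp => ⟨hp.1, by linarith [hp.2.1], by linarith [hp.2.2]⟩
    exact ((h1.sub h2).sub continuousOn_const).add (by fun_prop)
  obtain ⟨x, hx, s, hs, hGs, hfirst⟩ := exists_first_nonpos (isCompact_Sph n) hGc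
    (fun y hy => by
      simp only [hG, zero_add, mul_zero, add_zero]
      linarith [hh0 y hy]) (p := (z, t)) ⟨hz, ht, le_rfl⟩ hneg
  have hs0 : s ∈ Ico 0 T := ⟨hs.1.le, by linarith [hs.2]⟩
  have hs1 : s + h ∈ Ico 0 T := ⟨by linarith [hs.1], by linarith [hs.2]⟩
  have hd : ∀ y ∈ Sph n, HasDerivAt (fun r => G (y, r))
      (-(suppHessDet n (fun x => u x s) y ^ (-α)) - P.β (u y s - Φ.φ y s) -
        (-(suppHessDet n (fun x => u x (s + h)) y ^ (-α)) -
          P.β (u y (s + h) - Φ.φ y (s + h))) + ε) s := fun y hy => by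
    have h1 := hu.eqn y hy s ⟨hs.1, hs0.2⟩
    have h2 := (hu.eqn y hy (s + h) ⟨by linarith [hs.1], hs1.2⟩).comp_add_const s h
    exact (((h1.sub h2).sub_const (c * h)).add ((hasDerivAt_id s).const_mul ε)).congr_deriv
      (by rw [mul_one])
  have hnn : ∀ y ∈ Sph n, 0 ≤ G (y, s) := fun y hy => by
    refine ge_of_tendsto ((hd y hy).continuousAt.tendsto.mono_left
      (nhdsWithin_le_nhds (s := Iio s))) ?_
    filter_upwards [Ioo_mem_nhdsLT hs.1] with r hr
    exact (hfirst y hy r ⟨hr.1.le, hr.2⟩).le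
  have hG0 : G (x, s) = 0 := le_antisymm hGs (hnn x hx)
  have hder := deriv_nonpos_of_le_left hs.1 (hd x hx) fun r hr => by
    rw [hG0]
    exact (hfirst x hx r hr).le
  have hεs : ε * s ≤ c * h := (mul_le_mul_of_nonneg_left hs.2 hε.le).trans hε1
  have hgap : u x s - u x (s + h) = c * h - ε * s := by
    simp only [hG] at hG0
    linarith
  have hdet : suppHessDet n (fun y => u y (s + h)) x ≤ suppHessDet n (fun y => u y s) x := by
    refine suppHessDet_mono hx (hu.contDiffAt hs1 hx) (hu.contDiffAt hs0 hx) (hu.homog _ hs1)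
      (hu.homog _ hs0) (hu.strict_convex _ hs1 x hx) fun v hv => ?_
    refine hbil_le_of_min_sub hx (hu.contDiffAt hs1 hx) (hu.contDiffAt hs0 hx) (hu.homog _ hs1)
      (hu.homog _ hs0) (by linarith) (fun y hy => ?_) hv
    have := hnn y hy
    simp only [hG] at this
    linarith
  have hK := Real.rpow_le_rpow_of_nonpos (hu.suppHessDet_pos hs1 hx) hdet
    (neg_nonpos.2 hα.le)
  have hobst : Φ.φ x (s + h) + c * (s + h - s) ≤ Φ.φ x s :=
    add_mul_le_of_deriv_le (by linarith)
      (fun r hr => (Φ.hφt x hx r (hs.1.le.trans hr.1)).continuousAt.continuousWithinAt)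
      (fun r hr => Φ.hφt x hx r (hs.1.le.trans hr.1.le))
      fun r hr => by linarith [hφ x hx r ⟨hs.1.le.trans hr.1.le, hr.2.le.trans hs1.2.le⟩]
  have hβ : P.β (u x s - Φ.φ x s) ≤ P.β (u x (s + h) - Φ.φ x (s + h)) :=
    P.mono (by nlinarith [mul_pos hε hs.1])
  linarith

/-- The speed `K ^ α` of the flow is bounded below by any lower bound for the obstacle's speed that
lies below the initial speed. -/
lemma le_rpow_suppHessDet (hu : IsPenalizedSol n α T δ C₀ Φ P u) (hα : 0 < α) (hc : 0 < c)
    (hφ : ∀ z ∈ Sph n, ∀ t ∈ Icc 0 T, c ≤ -Φ.φt z t)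
    (hinit : ∀ z ∈ Sph n, c < suppHessDet n (fun x => u x 0) z ^ (-α) + P.β (u z 0 - Φ.φ z 0))
    (hz : z ∈ Sph n) {t : ℝ} (ht : t ∈ Ico 0 T) :
    c ≤ suppHessDet n (fun x => u x t) z ^ (-α) := by
  rcases ht.1.eq_or_lt with rfl | ht0
  · linarith [hinit z hz, P.nonpos (u z 0 - Φ.φ z 0)]
  obtain ⟨h₀, hh₀, -, hdec⟩ := hu.exists_short_time_decrease (ht0.trans ht.2) hinit
  have := deriv_le_of_increment_le (c := c) (lt_min hh₀ (sub_pos.2 ht.2))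
    (hu.eqn z hz t ⟨ht0, ht.2⟩) fun h hh =>
      hu.translate_decrease hα hc hφ hh.1 (hdec h ⟨hh.1, hh.2.trans_le (min_le_left _ _)⟩) hz ht.1
        (by linarith [hh.2.trans_le (min_le_right _ _)])
  linarith [P.nonpos (u z t - Φ.φ z t)]

end IsPenalizedSol

end Penalized

theorem statement_7 (n : ℕ) (hn : 0 < n) (α : ℝ) (hα : 0 < α)
    (T : ℝ) (hT : 0 < T) (Φ : ShrinkingObstacle n)
    (u₀ : ES n → ℝ) (hbody : IsSupportOfSmoothBody n u₀)
    (hencl : Encloses n α u₀ Φ)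
    (δ C₀ : ℝ) (hδ : 0 < δ) (hδ' : ∀ z ∈ Sph n, δ < u₀ z - Φ.φ z 0)
    (hC₀ : PenaltyConst n α Φ C₀) (P : Penalty δ C₀)
    (u : ES n → ℝ → ℝ) (hu : IsPenalizedSol n α T δ C₀ Φ P u)
    (hinit : ∀ z ∈ Sph n, u z 0 = u₀ z) :
    -- one may take `c_T = min_{𝕊ⁿ×[0,T]} (−∂_tφ)^{1/α}`
    0 < sInf {y : ℝ | ∃ z ∈ Sph n, ∃ t ∈ Set.Icc (0 : ℝ) T, y = (-Φ.φt z t) ^ α⁻¹} ∧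
      ∀ z ∈ Sph n, ∀ t ∈ Set.Ico (0 : ℝ) T,
        sInf {y : ℝ | ∃ z ∈ Sph n, ∃ t ∈ Set.Icc (0 : ℝ) T, y = (-Φ.φt z t) ^ α⁻¹} ≤
          (suppHessDet n (fun x => u x t) z)⁻¹ := by
  set S := {y : ℝ | ∃ z ∈ Sph n, ∃ t ∈ Set.Icc (0 : ℝ) T, y = (-Φ.φt z t) ^ α⁻¹} with hS
  obtain ⟨m, hm, hmle⟩ := Φ.exists_speed_lower_bound hT
  have hα' : 0 < α⁻¹ := inv_pos.2 hα
  have hlow : ∀ y ∈ S, m ^ α⁻¹ ≤ y := by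
    rintro y ⟨z, hz, t, ht, rfl⟩
    exact Real.rpow_le_rpow hm.le (hmle z hz t ht) hα'.le
  obtain ⟨z₀, hz₀⟩ := Sph_nonempty n
  have hpos : 0 < sInf S := (Real.rpow_pos_of_pos hm _).trans_le
    (le_csInf ⟨_, z₀, hz₀, 0, ⟨le_rfl, hT.le⟩, rfl⟩ hlow)
  refine ⟨hpos, fun z hz t ht => ?_⟩
  have hφ : ∀ z ∈ Sph n, ∀ t ∈ Icc 0 T, sInf S ^ α ≤ -Φ.φt z t := fun z hz t ht => by
    have h1 : sInf S ≤ (-Φ.φt z t) ^ α⁻¹ := csInf_le ⟨_, hlow⟩ ⟨z, hz, t, ht, rfl⟩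
    have h2 : 0 ≤ -Φ.φt z t := hm.le.trans (hmle z hz t ht)
    rwa [← Real.le_rpow_inv_iff_of_pos hpos.le h2 hα]
  have h0 : (0 : ℝ) ∈ Ico 0 T := ⟨le_rfl, hT⟩
  have hstart : ∀ z ∈ Sph n, sInf S ^ α <
      suppHessDet n (fun x => u x 0) z ^ (-α) + P.β (u z 0 - Φ.φ z 0) := fun z hz => by
    have hdet := suppHessDet_congr_of_eqOn_Sph (hu.homog 0 h0) hbody.1 hinit hz
    rw [hinit z hz, P.zero_of_ge _ (hδ' z hz).le, add_zero, Real.rpow_neg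
      (hu.suppHessDet_pos h0 hz).le, ← Real.inv_rpow (hu.suppHessDet_pos h0 hz).le, hdet]
    exact (hφ z hz 0 ⟨le_rfl, hT.le⟩).trans_lt (hencl.2.1 z hz z hz)
  have hK := hu.le_rpow_suppHessDet hα (Real.rpow_pos_of_pos hpos α) hφ hstart hz ht
  have hD := hu.suppHessDet_pos ht hz
  rw [Real.rpow_neg hD.le, ← Real.inv_rpow hD.le] at hK
  exact (Real.rpow_le_rpow_iff hpos.le (inv_pos.2 hD).le hα).1 hK
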